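/- arXiv:1511.02309 — 4 statements merged into one kernel-verified Lean document; each statement's English description precedes it below -/
import Mathlib

section
/- Let p = (p_1,...,p_N) be a probability vector and let ρ_1,...,ρ_N be density matrices on ℂ^n. Then the optimal success probability P* of distinguishing the states (ρ_x) prepared with probabilities (p_x) satisfies P* ≥ 2^{-H(p) + S(Σ_x p_x ρ_x) - Σ_x p_x S(ρ_x)}, where H(p) is the Shannon entropy of p and S denotes the von Neumann entropy. -/
open Matrix Finset Real
open scoped ComplexOrder

noncomputable section

/-- A density matrix: positive semidefinite with trace 1. -/
def IsDensityMatrix {m : Type*} [Fintype m] (ρ : Matrix m m ℂ) : Prop :=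
  ρ.PosSemidef ∧ ρ.trace = 1

/-- The von Neumann entropy (base 2) of a Hermitian matrix, via its eigenvalues. -/
def vonNeumannEntropy {m : Type*} [Fintype m] [DecidableEq m]
    (ρ : Matrix m m ℂ) (hρ : ρ.IsHermitian) : ℝ :=
  -∑ i, hρ.eigenvalues i * Real.logb 2 (hρ.eigenvalues i)

/-- The Shannon entropy (base 2) of a probability vector. -/
def shannonEntropy {N : ℕ} (p : Fin N → ℝ) : ℝ :=
  -∑ x, p x * Real.logb 2 (p x)

/-- A POVM with `N` outcomes: positive semidefinite operators summing to the identity. -/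
def IsPOVM {N n : ℕ} (M : Fin N → Matrix (Fin n) (Fin n) ℂ) : Prop :=
  (∀ x, (M x).PosSemidef) ∧ ∑ x, M x = 1

/-- The set of achievable success probabilities for discriminating the states `ρ x`
prepared with probabilities `p x`, over all POVMs with `N` outcomes. -/
def succProbs {N n : ℕ} (p : Fin N → ℝ) (ρ : Fin N → Matrix (Fin n) (Fin n) ℂ) : Set ℝ :=
  {s | ∃ M : Fin N → Matrix (Fin n) (Fin n) ℂ,
    IsPOVM M ∧ s = ∑ x, p x * ((M x * ρ x).trace).re}

/-- The outer product `|ψ⟩⟨ψ|` of a vector, with entries `ψ i * conj (ψ j)`. -/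
def outer {n : ℕ} (ψ : Fin n → ℂ) : Matrix (Fin n) (Fin n) ℂ :=
  Matrix.vecMulVec ψ (star ψ)

/-- Weighted Jensen inequality for the logarithm. -/
lemma logJ {ι : Type*} [Fintype ι] (q v : ι → ℝ) (hq : ∀ k, 0 ≤ q k) (h1 : ∑ k, q k = 1)
    (hv : ∀ k, q k ≠ 0 → 0 < v k) (C : ℝ) (hC : 0 < C) (h : ∑ k, q k * v k ≤ C) :
    ∑ k, q k * Real.log (v k) ≤ Real.log C := by
  have key : ∀ k, q k * Real.log (v k) ≤ q k * Real.log C + q k * v k / C - q k := by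
    intro k
    by_cases h0 : q k = 0
    · simp [h0]
    · have hvk := hv k h0
      have := Real.log_le_sub_one_of_pos (div_pos hvk hC)
      rw [Real.log_div hvk.ne' hC.ne'] at this
      have := mul_le_mul_of_nonneg_left this (hq k)
      have e : q k * v k / C = q k * (v k / C) := by ring
      rw [e]; nlinarith
  calc _ ≤ ∑ k, (q k * Real.log C + q k * v k / C - q k) := Finset.sum_le_sum fun k _ => key k
    _ = Real.log C + (∑ k, q k * v k) / C - 1 := by
        rw [Finset.sum_sub_distrib, Finset.sum_add_distrib, ← Finset.sum_mul, h1,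
          ← Finset.sum_div]; ring
    _ ≤ _ := by
        have : (∑ k, q k * v k) / C ≤ 1 := (div_le_one hC).2 h
        linarith

lemma c_pos {K J : Type*} [Fintype K] [Fintype J]
    (a : K → ℝ) (ha1 : ∑ k, a k = 1)
    (U : K → J → ℝ) (hU : ∀ k j, 0 ≤ U k j) (hU1 : ∀ k, ∑ j, U k j = 1)
    (s : J → ℝ) (hs : ∀ j, 0 ≤ s j) (hs2 : ∀ j, s j ^ 2 = ∑ k, a k ^ 2 * U k j) :
    0 < ∑ j, s j := by
  rcases (Finset.sum_nonneg fun j (_ : j ∈ Finset.univ) => hs j).lt_or_eq with h | h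
  · exact h
  exfalso
  have h0 := (Finset.sum_eq_zero_iff_of_nonneg fun j _ => hs j).1 h.symm
  have hz : ∀ k j, a k ^ 2 * U k j = 0 := by
    intro k j
    have := hs2 j
    rw [h0 j (Finset.mem_univ _)] at this
    have := (Finset.sum_eq_zero_iff_of_nonneg
      (fun k _ => mul_nonneg (sq_nonneg (a k)) (hU k j))).1 (by rw [← this]; norm_num)
    exact this k (Finset.mem_univ _)
  have : ∀ k, a k = 0 := by
    intro k
    have : ∑ j, a k ^ 2 * U k j = 0 := Finset.sum_eq_zero fun j _ => hz k j
    rw [← Finset.mul_sum, hU1] at this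
    simpa using this
  simp [this] at ha1

lemma numeric {K J L : Type*} [Fintype K] [Fintype J] [Fintype L]
    (a : K → ℝ) (ha : ∀ k, 0 ≤ a k) (ha1 : ∑ k, a k = 1)
    (U : K → J → ℝ) (hU : ∀ k j, 0 ≤ U k j) (hU1 : ∀ k, ∑ j, U k j = 1)
    (s : J → ℝ) (hs : ∀ j, 0 ≤ s j) (hs2 : ∀ j, s j ^ 2 = ∑ k, a k ^ 2 * U k j)
    (l : L → ℝ) (hl : ∀ k, 0 ≤ l k)
    (V : J → L → ℝ) (hV : ∀ j k, 0 ≤ V j k) (hV1 : ∀ j, ∑ k, V j k = 1)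
    (hV2 : ∀ k, ∑ j, V j k = 1)
    (hr : ∀ j, ∑ k, l k * V j k = ∑ k, a k * U k j) :
    ∑ k, a k * Real.log (a k) - ∑ k, l k * Real.log (l k) ≤ 2 * Real.log (∑ j, s j) := by
  have hc := c_pos a ha1 U hU hU1 s hs hs2
  have hsum : ∑ x : K × J, a x.1 * U x.1 x.2 = 1 := by
    simp only [Fintype.sum_prod_type, ← Finset.mul_sum, hU1, mul_one, ha1]
  have hsum2 : ∑ x : J × L, l x.2 * V x.1 x.2 = 1 := by
    rw [← hsum]
    simp only [Fintype.sum_prod_type, hr]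
    exact Finset.sum_comm
  have hs0 : ∀ k j, a k * U k j ≠ 0 → 0 < s j := by
    intro k j h
    refine lt_of_le_of_ne (hs j) fun h0 => h ?_
    have h3 := hs2 j
    rw [← h0] at h3
    have := (Finset.sum_eq_zero_iff_of_nonneg
      (fun k _ => mul_nonneg (sq_nonneg (a k)) (hU k j))).1 (by rw [← h3]; norm_num)
    simpa using this k (Finset.mem_univ _)
  have hs0' : ∀ j k, l k * V j k ≠ 0 → 0 < s j := by
    intro j k h
    by_contra hn
    have h2 : ∑ k, a k * U k j = 0 :=
      Finset.sum_eq_zero fun k _ => by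
        by_contra h3; exact hn (hs0 k j h3)
    rw [← hr] at h2
    exact h ((Finset.sum_eq_zero_iff_of_nonneg
      (fun k _ => mul_nonneg (hl k) (hV j k))).1 h2 k (Finset.mem_univ _))
  have A := logJ (fun x : K × J => a x.1 * U x.1 x.2) (fun x => a x.1 / s x.2)
    (fun x => mul_nonneg (ha _) (hU _ _)) hsum
    (fun x h => div_pos (lt_of_le_of_ne (ha _) fun h0 => h (by simp [← h0])) (hs0 _ _ h))
    (∑ j, s j) hc (by
      rw [Fintype.sum_prod_type_right]
      refine Finset.sum_le_sum fun j _ => ?_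
      have : ∀ k, a k * U k j * (a k / s j) = (a k ^ 2 * U k j) / s j := fun k => by ring
      simp only [this, ← Finset.sum_div, ← hs2]
      rcases eq_or_ne (s j) 0 with h | h
      · simp [h]
      · rw [sq, mul_div_cancel_right₀ _ h])
  have B := logJ (fun x : J × L => l x.2 * V x.1 x.2) (fun x => s x.1 / l x.2)
    (fun x => mul_nonneg (hl _) (hV _ _)) hsum2
    (fun x h => div_pos (hs0' _ _ h) (lt_of_le_of_ne (hl _) fun h0 => h (by simp [← h0])))
    (∑ j, s j) hc (by
      rw [Fintype.sum_prod_type]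
      refine Finset.sum_le_sum fun j _ => ?_
      calc _ ≤ ∑ k, V j k * s j := Finset.sum_le_sum fun k _ => by
            rcases eq_or_ne (l k) 0 with h | h
            · simpa [h] using mul_nonneg (hV j k) (hs j)
            · apply le_of_eq; field_simp
        _ = s j := by rw [← Finset.sum_mul, hV1, one_mul])
  have A' : ∑ x : K × J, a x.1 * U x.1 x.2 * Real.log (a x.1 / s x.2)
      = ∑ k, a k * Real.log (a k) - ∑ j, (∑ k, a k * U k j) * Real.log (s j) := by
    have : ∀ x : K × J, a x.1 * U x.1 x.2 * Real.log (a x.1 / s x.2)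
        = a x.1 * Real.log (a x.1) * U x.1 x.2 - a x.1 * U x.1 x.2 * Real.log (s x.2) := by
      intro x
      by_cases h : a x.1 * U x.1 x.2 = 0
      · rw [h]
        linear_combination (-Real.log (a x.1)) * h
      · rw [Real.log_div (fun h0 => h (by simp [h0])) (hs0 _ _ h).ne']; ring
    simp only [this, Finset.sum_sub_distrib]
    congr 1
    · simp only [Fintype.sum_prod_type, ← Finset.mul_sum, hU1, mul_one]
    · simp only [Fintype.sum_prod_type_right, ← Finset.sum_mul]
  have B' : ∑ x : J × L, l x.2 * V x.1 x.2 * Real.log (s x.1 / l x.2)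
      = ∑ j, (∑ k, a k * U k j) * Real.log (s j) - ∑ k, l k * Real.log (l k) := by
    have : ∀ x : J × L, l x.2 * V x.1 x.2 * Real.log (s x.1 / l x.2)
        = l x.2 * V x.1 x.2 * Real.log (s x.1) - l x.2 * Real.log (l x.2) * V x.1 x.2 := by
      intro x
      by_cases h : l x.2 * V x.1 x.2 = 0
      · rw [h]
        linear_combination (Real.log (l x.2)) * h
      · rw [Real.log_div (hs0' _ _ h).ne' (fun h0 => h (by simp [h0]))]; ring
    simp only [this, Finset.sum_sub_distrib]
    congr 1
    · simp only [Fintype.sum_prod_type, ← Finset.sum_mul, hr]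
    · simp only [Fintype.sum_prod_type_right, ← Finset.mul_sum, hV2, mul_one]
  linarith [A, B, A', B']

/-- spectral theorem in elementary form -/
lemma spec {n : ℕ} (A : Matrix (Fin n) (Fin n) ℂ) (hA : A.IsHermitian) :
    ∃ E : Matrix (Fin n) (Fin n) ℂ, E * Eᴴ = 1 ∧ Eᴴ * E = 1 ∧
      A = E * diagonal (fun i => (hA.eigenvalues i : ℂ)) * Eᴴ := by
  refine ⟨hA.eigenvectorUnitary, ?_, ?_, ?_⟩
  · exact Unitary.mul_star_self_of_mem hA.eigenvectorUnitary.2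
  · exact Unitary.star_mul_self_of_mem hA.eigenvectorUnitary.2
  · conv_lhs => rw [hA.spectral_theorem, Unitary.conjStarAlgAut_apply]
    rfl

/-- diagonal entries after change of basis -/
lemma diag_entry {n : ℕ} (Z : Matrix (Fin n) (Fin n) ℂ) (d : Fin n → ℝ) (j : Fin n) :
    (Zᴴ * diagonal (fun i => (d i : ℂ)) * Z) j j = ((∑ i, d i * ‖Z i j‖ ^ 2 : ℝ) : ℂ) := by
  rw [Matrix.mul_apply]
  push_cast
  refine Finset.sum_congr rfl fun i _ => ?_
  rw [Matrix.mul_diagonal, conjTranspose_apply, ← Complex.mul_conj', Complex.star_def]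
  ring

lemma col_sum {n : ℕ} (Z : Matrix (Fin n) (Fin n) ℂ) (h : Zᴴ * Z = 1) (j : Fin n) :
    ∑ i, ‖Z i j‖ ^ 2 = 1 := by
  have := diag_entry Z (fun _ => 1) j
  simp only [Complex.ofReal_one, diagonal_one, mul_one, h, one_mul, one_apply_eq] at this
  exact_mod_cast this.symm

lemma row_sum {n : ℕ} (Z : Matrix (Fin n) (Fin n) ℂ) (h : Z * Zᴴ = 1) (i : Fin n) :
    ∑ j, ‖Z i j‖ ^ 2 = 1 := by
  have := col_sum Zᴴ (by simpa using h) i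
  simpa using this

lemma trace_mul_re_nonneg {n : ℕ} (A B : Matrix (Fin n) (Fin n) ℂ) (hA : A.PosSemidef)
    (hB : B.PosSemidef) : 0 ≤ ((A * B).trace).re := by
  obtain ⟨E, h1, h2, h3⟩ := spec B hB.isHermitian
  rw [h3, ← mul_assoc, Matrix.trace_mul_comm, ← mul_assoc, ← mul_assoc]
  have hp := hA.conjTranspose_mul_mul_same E
  rw [Matrix.trace, Complex.re_sum]
  refine Finset.sum_nonneg fun i _ => ?_
  rw [Matrix.diag_apply, Matrix.mul_diagonal, Complex.re_mul_ofReal]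
  have := hp.diag_nonneg (i := i)
  exact mul_nonneg (Complex.nonneg_iff.1 this).1 (hB.eigenvalues_nonneg i)

/-- lower bound on a single term of the success probability -/
lemma term_bound {n : ℕ} (Y : Matrix (Fin n) (Fin n) ℂ) (hY : Y.IsHermitian) (a : Fin n → ℝ)
    (ha : ∀ i, 0 ≤ a i) :
    ∑ i, a i * (a i * (Y i i).re) ^ 2 ≤
      ((Y * diagonal (fun i => ((a i ^ 2 : ℝ) : ℂ)) * Y * diagonal (fun i => (a i : ℂ))).trace).re := by
  rw [Matrix.trace, Complex.re_sum]
  refine Finset.sum_le_sum fun k _ => ?_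
  rw [Matrix.diag_apply, Matrix.mul_diagonal, Complex.re_mul_ofReal, mul_comm]
  refine mul_le_mul_of_nonneg_right ?_ (ha k)
  have := diag_entry Y (fun i => a i ^ 2) k
  rw [hY.eq] at this
  rw [this, Complex.ofReal_re]
  refine le_trans ?_ (Finset.single_le_sum (f := fun i => a i ^ 2 * ‖Y i k‖ ^ 2)
    (fun i _ => by positivity) (Finset.mem_univ k))
  rw [mul_pow]
  refine mul_le_mul_of_nonneg_left ?_ (sq_nonneg _)
  exact sq_le_sq' (by linarith [Complex.abs_re_le_norm (Y k k), neg_abs_le (Y k k).re])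
    (Complex.re_le_norm _)

lemma inner_le_aux {ι : Type*} [Fintype ι] (q v : ι → ℝ) (hq : ∀ k, 0 ≤ q k)
    (h1 : ∑ k, q k = 1) : (∑ k, q k * v k) ^ 2 ≤ ∑ k, q k * v k ^ 2 := by
  have h : 0 ≤ ∑ k, q k * (v k - ∑ k, q k * v k) ^ 2 :=
    Finset.sum_nonneg fun k _ => mul_nonneg (hq k) (sq_nonneg _)
  generalize hm : ∑ k, q k * v k = m at h ⊢
  have e : ∑ k, q k * (v k - m) ^ 2 = ∑ k, q k * v k ^ 2 - 2 * m * ∑ k, q k * v k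
      + m ^ 2 * ∑ k, q k := by
    rw [Finset.mul_sum _ _ (2 * m), Finset.mul_sum _ _ (m ^ 2), ← Finset.sum_sub_distrib, ← Finset.sum_add_distrib]
    exact Finset.sum_congr rfl fun k _ => by ring
  rw [e, h1, hm] at h
  linarith

lemma eig_sum {n : ℕ} (A : Matrix (Fin n) (Fin n) ℂ) (hA : A.IsHermitian) (h : A.trace = 1) :
    ∑ i, hA.eigenvalues i = 1 := by
  have h2 : ((∑ i, hA.eigenvalues i : ℝ) : ℂ) = 1 := by
    rw [← h, hA.trace_eq_sum_eigenvalues, Complex.ofReal_sum]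
    rfl
  exact_mod_cast h2

/-- success probabilities are bounded -/
lemma succ_bdd {N n : ℕ} (p : Fin N → ℝ) (hp : ∀ x, 0 ≤ p x)
    (ρ : Fin N → Matrix (Fin n) (Fin n) ℂ) (hρ : ∀ x, IsDensityMatrix (ρ x)) :
    BddAbove (succProbs p ρ) := by
  refine ⟨∑ x, p x, ?_⟩
  rintro s ⟨M, hM, rfl⟩
  refine Finset.sum_le_sum fun x _ => ?_
  have h1 : ((1 - M x).PosSemidef) := by
    have : 1 - M x = ∑ y ∈ Finset.univ.erase x, M y := by
      rw [← hM.2, ← Finset.add_sum_erase _ _ (Finset.mem_univ x), add_sub_cancel_left]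
    rw [this]
    exact Matrix.posSemidef_sum _ fun y _ => hM.1 y
  have h2 := trace_mul_re_nonneg _ _ h1 (hρ x).1
  rw [sub_mul, one_mul, Matrix.trace_sub, (hρ x).2, Complex.sub_re, Complex.one_re] at h2
  have := mul_le_mul_of_nonneg_left (show ((M x * ρ x).trace).re ≤ 1 by linarith) (hp x)
  simpa using this

lemma conj_diag_mul {n : ℕ} (E : Matrix (Fin n) (Fin n) ℂ) (h : Eᴴ * E = 1) (d e : Fin n → ℂ) :
    (E * diagonal d * Eᴴ) * (E * diagonal e * Eᴴ) = E * diagonal (fun i => d i * e i) * Eᴴ := by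
  rw [← Matrix.diagonal_mul_diagonal]
  calc _ = E * diagonal d * (Eᴴ * E) * diagonal e * Eᴴ := by simp only [Matrix.mul_assoc]
    _ = _ := by rw [h, mul_one]; simp only [Matrix.mul_assoc]

lemma main_aux {N n : ℕ}
    (p : Fin N → ℝ) (hp : ∀ x, 0 ≤ p x) (hp1 : ∑ x, p x = 1)
    (ρ : Fin N → Matrix (Fin n) (Fin n) ℂ) (hρ : ∀ x, IsDensityMatrix (ρ x))
    (hmix : (∑ x, (p x : ℂ) • ρ x).IsHermitian) :
    ∃ c : ℝ, 0 < c ∧ c ^ 2 ≤ sSup (succProbs p ρ) ∧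
      ∑ y : Fin N × Fin n, (p y.1 * (hρ y.1).1.isHermitian.eigenvalues y.2) *
        Real.log (p y.1 * (hρ y.1).1.isHermitian.eigenvalues y.2)
      - ∑ k, hmix.eigenvalues k * Real.log (hmix.eigenvalues k) ≤ 2 * Real.log c := by
  set μ : Fin N → Fin n → ℝ := fun x => (hρ x).1.isHermitian.eigenvalues with hμ
  have hμ0 : ∀ x i, 0 ≤ μ x i := fun x i => (hρ x).1.eigenvalues_nonneg i
  have hμ1 : ∀ x, ∑ i, μ x i = 1 := fun x => eig_sum _ _ (hρ x).2
  choose E hE1 hE2 hE3 using fun x => spec (ρ x) (hρ x).1.isHermitian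
  set a : Fin N → Fin n → ℝ := fun x i => p x * μ x i with ha
  have ha0 : ∀ x i, 0 ≤ a x i := fun x i => mul_nonneg (hp x) (hμ0 x i)
  have ha1 : ∑ y : Fin N × Fin n, a y.1 y.2 = 1 := by
    simp only [Fintype.sum_prod_type, ha, ← Finset.mul_sum, hμ1, mul_one, hp1]
  have hA : ∀ x, (p x : ℂ) • ρ x = E x * diagonal (fun i => (a x i : ℂ)) * (E x)ᴴ := by
    intro x
    conv_lhs => rw [hE3 x]
    rw [← Matrix.smul_mul, ← Matrix.mul_smul, ← Matrix.diagonal_smul]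
    congr 3
    ext i
    simp [ha, hμ]
  set B : Fin N → Matrix (Fin n) (Fin n) ℂ :=
    fun x => E x * diagonal (fun i => ((a x i ^ 2 : ℝ) : ℂ)) * (E x)ᴴ with hB
  have hBp : ∀ x, (B x).PosSemidef := fun x =>
    (PosSemidef.diagonal (fun i => by
      simpa using Complex.zero_le_real.2 (sq_nonneg (a x i)))).mul_mul_conjTranspose_same (E x)
  have hG : (∑ x, B x).PosSemidef := Matrix.posSemidef_sum _ fun x _ => hBp x
  obtain ⟨F, hF1, hF2, hF3⟩ := spec _ hG.isHermitian
  obtain ⟨H, hH1, hH2, hH3⟩ := spec _ hmix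
  set g := hG.isHermitian.eigenvalues with hg
  have hg0 : ∀ j, 0 ≤ g j := fun j => hG.eigenvalues_nonneg j
  set s : Fin n → ℝ := fun j => Real.sqrt (g j) with hs
  have hs0 : ∀ j, 0 ≤ s j := fun j => Real.sqrt_nonneg _
  have hsg : ∀ j, s j ^ 2 = g j := fun j => Real.sq_sqrt (hg0 j)
  set Z : Fin N → Matrix (Fin n) (Fin n) ℂ := fun x => (E x)ᴴ * F with hZ
  have hZ1 : ∀ x, Z x * (Z x)ᴴ = 1 := by
    intro x
    simp only [hZ, conjTranspose_mul, conjTranspose_conjTranspose]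
    calc _ = (E x)ᴴ * (F * Fᴴ) * E x := by simp only [Matrix.mul_assoc]
      _ = 1 := by rw [hF1, mul_one, hE2]
  set U : Fin N × Fin n → Fin n → ℝ := fun y j => ‖Z y.1 y.2 j‖ ^ 2 with hU
  have hU0 : ∀ y j, 0 ≤ U y j := fun y j => sq_nonneg _
  have hU1 : ∀ y, ∑ j, U y j = 1 := fun y => row_sum _ (hZ1 y.1) _
  set T := Hᴴ * F with hT
  set V : Fin n → Fin n → ℝ := fun j k => ‖T k j‖ ^ 2 with hV
  have hV1 : ∀ j, ∑ k, V j k = 1 := fun j => col_sum T (by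
    simp only [hT, conjTranspose_mul, conjTranspose_conjTranspose]
    calc _ = Fᴴ * (H * Hᴴ) * F := by simp only [Matrix.mul_assoc]
      _ = 1 := by rw [hH1, mul_one, hF2]) j
  have hV2 : ∀ k, ∑ j, V j k = 1 := fun k => row_sum T (by
    simp only [hT, conjTranspose_mul, conjTranspose_conjTranspose]
    calc _ = Hᴴ * (F * Fᴴ) * H := by simp only [Matrix.mul_assoc]
      _ = 1 := by rw [hF1, mul_one, hH2]) k
  -- diagonal entries in the basis `F`
  have hentry : ∀ (Q : Matrix (Fin n) (Fin n) ℂ) (d : Fin n → ℝ) (j : Fin n),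
      (Fᴴ * (Q * diagonal (fun i => (d i : ℂ)) * Qᴴ) * F) j j
        = ((∑ i, d i * ‖(Qᴴ * F) i j‖ ^ 2 : ℝ) : ℂ) := by
    intro Q d j
    rw [← diag_entry]
    simp only [conjTranspose_mul, conjTranspose_conjTranspose, Matrix.mul_assoc]
  have hs2 : ∀ j, s j ^ 2 = ∑ y : Fin N × Fin n, a y.1 y.2 ^ 2 * U y j := by
    intro j
    have h1 : (Fᴴ * (∑ x, B x) * F) j j = (g j : ℂ) := by
      rw [hF3]
      have : Fᴴ * (F * diagonal (fun i => (g i : ℂ)) * Fᴴ) * F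
          = (Fᴴ * F) * diagonal (fun i => (g i : ℂ)) * (Fᴴ * F) := by
        simp only [Matrix.mul_assoc]
      rw [this, hF2]; simp
    have h2 : (Fᴴ * (∑ x, B x) * F) j j =
        ((∑ y : Fin N × Fin n, a y.1 y.2 ^ 2 * U y j : ℝ) : ℂ) := by
      rw [Matrix.mul_sum, Matrix.sum_mul, Matrix.sum_apply, Fintype.sum_prod_type,
        Complex.ofReal_sum]
      exact Finset.sum_congr rfl fun x _ => hentry (E x) (fun i => a x i ^ 2) j
    rw [hsg]
    exact_mod_cast h1.symm.trans h2
  have hr : ∀ j, ∑ k, hmix.eigenvalues k * V j k = ∑ y : Fin N × Fin n, a y.1 y.2 * U y j := by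
    intro j
    have h1 : (Fᴴ * (∑ x, (p x : ℂ) • ρ x) * F) j j
        = ((∑ k, hmix.eigenvalues k * V j k : ℝ) : ℂ) := by
      rw [← hentry H hmix.eigenvalues j, ← hH3]
    have h2 : (Fᴴ * (∑ x, (p x : ℂ) • ρ x) * F) j j =
        ((∑ y : Fin N × Fin n, a y.1 y.2 * U y j : ℝ) : ℂ) := by
      rw [Matrix.mul_sum, Matrix.sum_mul, Matrix.sum_apply, Fintype.sum_prod_type,
        Complex.ofReal_sum]
      exact Finset.sum_congr rfl fun x _ => by rw [hA]; exact hentry (E x) (a x) j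
    exact_mod_cast h1.symm.trans h2
  have hml : ∀ k, 0 ≤ hmix.eigenvalues k := by
    have : (∑ x, (p x : ℂ) • ρ x).PosSemidef := Matrix.posSemidef_sum _ fun x _ =>
      (hρ x).1.smul (Complex.zero_le_real.2 (hp x))
    exact fun k => this.eigenvalues_nonneg k
  have hcpos := c_pos (fun y : Fin N × Fin n => a y.1 y.2) ha1 U hU0 hU1 s hs0 hs2
  refine ⟨∑ j, s j, hcpos, ?_,
    numeric (fun y : Fin N × Fin n => a y.1 y.2) (fun y => ha0 _ _) ha1 U hU0 hU1 s hs0 hs2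
      hmix.eigenvalues hml V (fun _ _ => sq_nonneg _) hV1 hV2 hr⟩
  -- the measurement
  set W : Matrix (Fin n) (Fin n) ℂ := F * diagonal (fun j => (((s j)⁻¹ : ℝ) : ℂ)) * Fᴴ with hW
  have hWH : Wᴴ = W := by
    have hd : (diagonal (fun j => (((s j)⁻¹ : ℝ) : ℂ)))ᴴ = diagonal (fun j => (((s j)⁻¹ : ℝ) : ℂ)) := by
      rw [diagonal_conjTranspose]
      congr 1
      ext j
      exact Complex.conj_ofReal _
    rw [hW, conjTranspose_mul, conjTranspose_mul, conjTranspose_conjTranspose, hd,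
      Matrix.mul_assoc]
  have hWB : ∀ x, (W * B x * W).PosSemidef := fun x => by
    have := (hBp x).mul_mul_conjTranspose_same W
    rwa [hWH] at this
  set R : Matrix (Fin n) (Fin n) ℂ := 1 - W * (∑ x, B x) * W with hR
  have hRp : R.PosSemidef := by
    have : R = F * diagonal (fun j => ((1 - (s j)⁻¹ * g j * (s j)⁻¹ : ℝ) : ℂ)) * Fᴴ := by
      rw [hR, hF3, hW, conj_diag_mul F hF2, conj_diag_mul F hF2]
      conv_lhs => rw [← hF1]
      have : (diagonal (fun j => ((1 - (s j)⁻¹ * g j * (s j)⁻¹ : ℝ) : ℂ)))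
          = 1 - diagonal (fun j => (((s j)⁻¹ : ℝ) : ℂ) * (g j : ℂ) * (((s j)⁻¹ : ℝ) : ℂ)) := by
        rw [← diagonal_one, diagonal_sub]
        congr 1
        ext j
        push_cast
        ring
      rw [this, Matrix.mul_sub, Matrix.sub_mul, mul_one]
    rw [this]
    refine (PosSemidef.diagonal (fun j => ?_)).mul_mul_conjTranspose_same F
    refine Complex.zero_le_real.2 ?_
    rw [← hsg]
    rcases eq_or_ne (s j) 0 with h | h
    · simp [h]
    · have : (s j)⁻¹ * s j ^ 2 * (s j)⁻¹ = 1 := by field_simp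
      rw [this, sub_self]
  have hN : 0 < N := by
    rcases Nat.eq_zero_or_pos N with h | h
    · subst h; simp at hp1
    · exact h
  let x0 : Fin N := ⟨0, hN⟩
  let M : Fin N → Matrix (Fin n) (Fin n) ℂ := fun x => W * B x * W + if x = x0 then R else 0
  have hif : ∀ x, (if x = x0 then R else 0).PosSemidef := fun x => by
    split_ifs
    · exact hRp
    · exact PosSemidef.zero
  have hM : IsPOVM M := by
    refine ⟨fun x => (hWB x).add (hif x), ?_⟩
    simp only [M, Finset.sum_add_distrib, Finset.sum_ite_eq', Finset.mem_univ, if_true]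
    rw [← Matrix.sum_mul, ← Matrix.mul_sum, hR]
    abel
  refine le_trans ?_ (le_csSup (succ_bdd p hp ρ hρ) ⟨M, hM, rfl⟩)
  set Y : Fin N → Matrix (Fin n) (Fin n) ℂ := fun x => (E x)ᴴ * W * E x with hY
  have hYH : ∀ x, (Y x).IsHermitian := fun x => by
    simp only [hY, Matrix.IsHermitian, conjTranspose_mul, conjTranspose_conjTranspose, hWH,
      Matrix.mul_assoc]
  have hYd : ∀ x i, (Y x i i).re = ∑ j, (s j)⁻¹ * U (x, i) j := by
    intro x i
    have := diag_entry (Z x)ᴴ (fun j => (s j)⁻¹) i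
    have e : (Z x)ᴴᴴ * diagonal (fun j => (((s j)⁻¹ : ℝ) : ℂ)) * (Z x)ᴴ = Y x := by
      simp only [hZ, hY, hW, conjTranspose_mul, conjTranspose_conjTranspose, Matrix.mul_assoc]
    rw [e] at this
    rw [this, Complex.ofReal_re]
    simp [hU]
  have hterm : ∀ x, ∑ i, a x i * (a x i * (Y x i i).re) ^ 2 ≤ p x * ((M x * ρ x).trace).re := by
    intro x
    have h1 := term_bound (Y x) (hYH x) (a x) (ha0 x)
    have h2 : (Y x * diagonal (fun i => ((a x i ^ 2 : ℝ) : ℂ)) * Y x *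
        diagonal (fun i => (a x i : ℂ))).trace = (W * B x * W * ((p x : ℂ) • ρ x)).trace := by
      rw [hA x]
      have : W * B x * W * (E x * diagonal (fun i => (a x i : ℂ)) * (E x)ᴴ)
        = (W * B x * W * E x * diagonal (fun i => (a x i : ℂ))) * (E x)ᴴ := by
        simp only [Matrix.mul_assoc]
      rw [this, Matrix.trace_mul_comm _ (E x)ᴴ]
      simp only [hY, hB, Matrix.mul_assoc]
    rw [h2, Matrix.mul_smul, Matrix.trace_smul, smul_eq_mul, Complex.re_ofReal_mul] at h1
    refine h1.trans (mul_le_mul_of_nonneg_left ?_ (hp x))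
    simp only [M]
    rw [add_mul, Matrix.trace_add, Complex.add_re]
    linarith [trace_mul_re_nonneg _ _ (hif x) (hρ x).1]
  refine le_trans ?_ (Finset.sum_le_sum fun x _ => hterm x)
  rw [← Fintype.sum_prod_type' (f := fun x i => a x i * (a x i * (Y x i i).re) ^ 2)]
  have hc : ∑ j, s j = ∑ y : Fin N × Fin n, a y.1 y.2 * (a y.1 y.2 * (Y y.1 y.2 y.2).re) := by
    simp only [hYd, Finset.mul_sum]
    rw [Finset.sum_comm]
    refine Finset.sum_congr rfl fun j _ => ?_
    have : ∀ y : Fin N × Fin n, a y.1 y.2 * (a y.1 y.2 * ((s j)⁻¹ * U (y.1, y.2) j))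
      = (a y.1 y.2 ^ 2 * U y j) * (s j)⁻¹ := fun y => by ring
    simp only [this, ← Finset.sum_mul, ← hs2]
    rcases eq_or_ne (s j) 0 with h | h
    · simp [h]
    · field_simp
  rw [hc]
  exact inner_le_aux _ _ (fun y => ha0 _ _) ha1

/-- entropic lower bound
`P* ≥ 2^{-H(p) + S(Σ p_x ρ_x) - Σ p_x S(ρ_x)}`. -/
theorem entropic_lower_bound {N n : ℕ}
    (p : Fin N → ℝ) (hp : ∀ x, 0 ≤ p x) (hp1 : ∑ x, p x = 1)
    (ρ : Fin N → Matrix (Fin n) (Fin n) ℂ) (hρ : ∀ x, IsDensityMatrix (ρ x))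
    (hmix : (∑ x, (p x : ℂ) • ρ x).IsHermitian) :
    sSup (succProbs p ρ) ≥
      (2 : ℝ) ^ (-(shannonEntropy p) + vonNeumannEntropy (∑ x, (p x : ℂ) • ρ x) hmix
        - ∑ x, p x * vonNeumannEntropy (ρ x) (hρ x).1.isHermitian) := by


  obtain ⟨c, hc, hcs, hb⟩ := main_aux p hp hp1 ρ hρ hmix
  refine ge_iff_le.2 (le_trans ?_ hcs)
  have hμ1 : ∀ x, ∑ i, (hρ x).1.isHermitian.eigenvalues i = 1 := fun x => eig_sum _ _ (hρ x).2
  have hl2 : 0 < Real.log 2 := Real.log_pos (by norm_num)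
  have e1 : ∑ y : Fin N × Fin n, (p y.1 * (hρ y.1).1.isHermitian.eigenvalues y.2) *
        Real.log (p y.1 * (hρ y.1).1.isHermitian.eigenvalues y.2)
      = ∑ x, p x * Real.log (p x) + ∑ x, p x * ∑ i, (hρ x).1.isHermitian.eigenvalues i *
        Real.log ((hρ x).1.isHermitian.eigenvalues i) := by
    rw [Fintype.sum_prod_type, ← Finset.sum_add_distrib]
    refine Finset.sum_congr rfl fun x _ => ?_
    have h : ∀ i, (p x * (hρ x).1.isHermitian.eigenvalues i) *
        Real.log (p x * (hρ x).1.isHermitian.eigenvalues i)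
        = p x * Real.log (p x) * (hρ x).1.isHermitian.eigenvalues i
          + p x * ((hρ x).1.isHermitian.eigenvalues i *
            Real.log ((hρ x).1.isHermitian.eigenvalues i)) := by
      intro i
      rcases eq_or_ne (p x) 0 with h0 | h0
      · simp [h0]
      rcases eq_or_ne ((hρ x).1.isHermitian.eigenvalues i) 0 with hm0 | hm0
      · simp [hm0]
      rw [Real.log_mul h0 hm0]; ring
    simp only [h, Finset.sum_add_distrib, ← Finset.mul_sum, hμ1, mul_one]
  rw [e1] at hb
  have e2 : -(shannonEntropy p) + vonNeumannEntropy (∑ x, (p x : ℂ) • ρ x) hmix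
        - ∑ x, p x * vonNeumannEntropy (ρ x) (hρ x).1.isHermitian
      = (∑ x, p x * Real.log (p x) + ∑ x, p x * ∑ i, (hρ x).1.isHermitian.eigenvalues i *
        Real.log ((hρ x).1.isHermitian.eigenvalues i)
        - ∑ k, hmix.eigenvalues k * Real.log (hmix.eigenvalues k)) / Real.log 2 := by
    simp only [shannonEntropy, vonNeumannEntropy, Real.logb, ← mul_div_assoc, ← Finset.sum_div,
      mul_neg, Finset.sum_neg_distrib]
    ring
  rw [e2, Real.rpow_def_of_pos (by norm_num), mul_div_cancel₀ _ hl2.ne']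
  refine (Real.exp_le_exp.2 hb).trans (le_of_eq ?_)
  rw [two_mul, Real.exp_add, Real.exp_log hc, sq]
end
end

section
/- Let ψ_1,...,ψ_N be unit vectors in ℂ^n and let ρ_x = |ψ_x⟩⟨ψ_x| be the corresponding rank-one projections, prepared with probabilities p_1,...,p_N. Then the optimal success probability P* of distinguishing the states satisfies P* ≥ 2^{S(Σ_x p_x |ψ_x⟩⟨ψ_x|)} / N, where S denotes the von Neumann entropy. -/
open Matrix Finset Real
open scoped ComplexOrder

noncomputable section

theorem tr_outer {n : ℕ} (M : Matrix (Fin n) (Fin n) ℂ) (v : Fin n → ℂ) :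
    (M * outer v).trace = star v ⬝ᵥ (M *ᵥ v) := by
  rw [outer, Matrix.mul_vecMulVec, Matrix.trace_vecMulVec, dotProduct_comm]

theorem norm_dot {n : ℕ} (v : Fin n → ℂ) (h : ∑ i, ‖v i‖ ^ 2 = 1) : star v ⬝ᵥ v = 1 := by
  have : star v ⬝ᵥ v = ((∑ i, ‖v i‖ ^ 2 : ℝ) : ℂ) := by
    simp only [dotProduct, Pi.star_apply, Complex.ofReal_sum]
    refine Finset.sum_congr rfl fun i _ => ?_
    rw [Complex.star_def, Complex.conj_mul']
    push_cast; rfl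
  rw [this, h]; simp

theorem bdd_succ {N n : ℕ} (p : Fin N → ℝ) (hp : ∀ x, 0 ≤ p x)
    (ψ : Fin N → (Fin n → ℂ)) (hψ : ∀ x, ∑ i, ‖ψ x i‖ ^ 2 = 1) :
    BddAbove (succProbs p (fun x => outer (ψ x))) := by
  refine ⟨∑ x, p x, ?_⟩
  rintro s ⟨M, ⟨hM, hM1⟩, rfl⟩
  refine Finset.sum_le_sum fun x _ => ?_
  refine mul_le_of_le_one_right (hp x) ?_
  have h0 : ∀ y, 0 ≤ (star (ψ x) ⬝ᵥ (M y *ᵥ ψ x)).re := fun y =>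
    (Complex.le_def.1 ((hM y).dotProduct_mulVec_nonneg (ψ x))).1
  have h1 : ∑ y, (star (ψ x) ⬝ᵥ (M y *ᵥ ψ x)).re = 1 := by
    rw [← Complex.re_sum, ← dotProduct_sum, ← Matrix.sum_mulVec, hM1, Matrix.one_mulVec,
      norm_dot _ (hψ x)]; simp
  simp only [tr_outer]
  rw [← h1]
  exact Finset.single_le_sum (f := fun y => (star (ψ x) ⬝ᵥ (M y *ᵥ ψ x)).re)
    (fun y _ => h0 y) (Finset.mem_univ x)

theorem ent_le {n : ℕ} (l : Fin n → ℝ) (h0 : ∀ i, 0 ≤ l i) (h1 : ∑ i, l i = 1) :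
    (2 : ℝ) ^ (-∑ i, l i * Real.logb 2 (l i)) ≤ (∑ i, √(l i)) ^ 2 := by
  set T := ∑ i, √(l i) with hT
  have hTpos : 0 < T := by
    have : 1 ≤ T := by
      rw [← h1]
      refine Finset.sum_le_sum fun i _ => ?_
      have : l i ≤ 1 := by
        rw [← h1]; exact Finset.single_le_sum (fun y _ => h0 y) (Finset.mem_univ i)
      exact Real.le_sqrt_of_sq_le (by nlinarith [h0 i])
    linarith
  have key : ∀ i, -(l i * Real.log (l i)) - 2 * (l i * Real.log T) ≤ 2 * (√(l i) / T - l i) := by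
    intro i
    rcases (h0 i).eq_or_lt with h | h
    · simp [← h]
    · have hs : 0 < √(l i) := Real.sqrt_pos.2 h
      have hl := Real.log_le_sub_one_of_pos (x := (√(l i) * T)⁻¹) (by positivity)
      rw [Real.log_inv, Real.log_mul hs.ne' hTpos.ne', Real.log_sqrt h.le] at hl
      have h2 := mul_le_mul_of_nonneg_left hl (by positivity : 0 ≤ 2 * l i)
      have h3 : 2 * l i * ((√(l i) * T)⁻¹ - 1) = 2 * (√(l i) / T - l i) := by
        have : l i = √(l i) * √(l i) := (Real.mul_self_sqrt h.le).symm
        have e : l i * (√(l i) * T)⁻¹ = √(l i) / T := by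
          nth_rewrite 1 [this]; field_simp
        linear_combination 2 * e
      rw [h3] at h2
      linarith
  have hsum := Finset.sum_le_sum fun i (_ : i ∈ Finset.univ) => key i
  rw [Finset.sum_sub_distrib, ← Finset.mul_sum, ← Finset.mul_sum, ← Finset.sum_mul,
    Finset.sum_sub_distrib, ← Finset.sum_div, h1, ← hT, div_self hTpos.ne',
    Finset.sum_neg_distrib] at hsum
  rw [Real.rpow_def_of_pos (by norm_num), ← Real.le_log_iff_exp_le (by positivity), Real.log_pow]
  have : Real.log 2 * -∑ i, l i * Real.logb 2 (l i) = -∑ i, l i * Real.log (l i) := by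
    rw [mul_neg, Finset.mul_sum]
    congr 1
    refine Finset.sum_congr rfl fun i _ => ?_
    rw [Real.logb]
    have : Real.log 2 ≠ 0 := (Real.log_pos (by norm_num)).ne'
    field_simp
  rw [this]
  push_cast
  linarith

/-- Spectral functional calculus data for the pretty good measurement. -/
theorem spec_s1 {n : ℕ} (R : Matrix (Fin n) (Fin n) ℂ) (hR : R.PosSemidef) (h : R.IsHermitian) :
    ∃ A : Matrix (Fin n) (Fin n) ℂ, A.IsHermitian ∧ (1 - A * R * A).PosSemidef ∧
      (A * R).trace = ((∑ i, √(h.eigenvalues i) : ℝ) : ℂ) := by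
  have h0 : ∀ i, 0 ≤ h.eigenvalues i := fun i => hR.eigenvalues_nonneg i
  set U : Matrix (Fin n) (Fin n) ℂ := (h.eigenvectorUnitary : Matrix (Fin n) (Fin n) ℂ) with hU
  have hU1 : star U * U = 1 := Unitary.coe_star_mul_self h.eigenvectorUnitary
  have hU2 : U * star U = 1 := Unitary.coe_mul_star_self h.eigenvectorUnitary
  set D : Matrix (Fin n) (Fin n) ℂ := diagonal fun i => ((h.eigenvalues i : ℝ) : ℂ) with hD
  have hs : R = U * D * star U := by
    have := h.spectral_theorem
    rw [Unitary.conjStarAlgAut_apply] at this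
    exact this
  set B : Matrix (Fin n) (Fin n) ℂ := diagonal fun i => (((√(h.eigenvalues i))⁻¹ : ℝ) : ℂ) with hB
  have hAR : U * B * star U * R = U * (B * D) * star U := by
    calc U * B * star U * R = U * B * (star U * U) * D * star U := by
          conv_lhs => rw [hs]
          simp only [Matrix.mul_assoc]
      _ = _ := by rw [hU1]; simp only [Matrix.mul_assoc, Matrix.one_mul]
  refine ⟨U * B * star U, ?_, ?_, ?_⟩
  · rw [star_eq_conjTranspose]
    refine Matrix.isHermitian_mul_mul_conjTranspose U ?_
    rw [hB]
    refine Matrix.isHermitian_diagonal_of_self_adjoint _ ?_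
    ext i; simp
  · have : 1 - U * B * star U * R * (U * B * star U) = U * (1 - B * D * B) * star U := by
      rw [hAR, Matrix.mul_sub, Matrix.sub_mul, Matrix.mul_one, hU2]
      congr 1
      calc _ = U * (B * D) * (star U * U) * B * star U := by simp only [Matrix.mul_assoc]
        _ = _ := by rw [hU1]; simp only [Matrix.mul_assoc, Matrix.one_mul]
    rw [this, star_eq_conjTranspose]
    refine Matrix.PosSemidef.mul_mul_conjTranspose_same ?_ U
    rw [hB, hD, diagonal_mul_diagonal, diagonal_mul_diagonal, ← diagonal_one, diagonal_sub]
    refine Matrix.PosSemidef.diagonal fun i => ?_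
    simp only [Pi.zero_apply]
    rw [← Complex.ofReal_mul, ← Complex.ofReal_mul, ← Complex.ofReal_one, ← Complex.ofReal_sub,
      ← Complex.ofReal_zero, Complex.real_le_real]
    rcases (h0 i).eq_or_lt with e | e
    · simp [← e]
    · have hs : 0 < √(h.eigenvalues i) := Real.sqrt_pos.2 e
      have h2 := Real.mul_self_sqrt e.le
      have : (√(h.eigenvalues i))⁻¹ * h.eigenvalues i * (√(h.eigenvalues i))⁻¹ = 1 := by
        field_simp
        linarith
      rw [this]; simp
  · rw [hAR, Matrix.trace_mul_comm, ← Matrix.mul_assoc, hU1, Matrix.one_mul, hB, hD,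
      diagonal_mul_diagonal, trace_diagonal, Complex.ofReal_sum]
    refine Finset.sum_congr rfl fun i _ => ?_
    rw [← Complex.ofReal_mul]
    congr 1
    rcases (h0 i).eq_or_lt with e | e
    · simp [← e]
    · have hs : 0 < √(h.eigenvalues i) := Real.sqrt_pos.2 e
      have h2 := Real.mul_self_sqrt e.le
      field_simp
      linarith

theorem outer_psd {n : ℕ} (v : Fin n → ℂ) : (outer v).PosSemidef :=
  Matrix.posSemidef_vecMulVec_self_star v

/-- for pure states, `P* ≥ 2^{S(Σ p_x |ψ_x⟩⟨ψ_x|)} / N`. -/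
theorem entropic_lower_bound_pure {N n : ℕ}
    (p : Fin N → ℝ) (hp : ∀ x, 0 ≤ p x) (hp1 : ∑ x, p x = 1)
    (ψ : Fin N → (Fin n → ℂ)) (hψ : ∀ x, ∑ i, ‖ψ x i‖ ^ 2 = 1)
    (hmix : (∑ x, (p x : ℂ) • outer (ψ x)).IsHermitian) :
    sSup (succProbs p (fun x => outer (ψ x))) ≥
      (2 : ℝ) ^ (vonNeumannEntropy (∑ x, (p x : ℂ) • outer (ψ x)) hmix) / N := by
  have hpc : ∀ x, (0 : ℂ) ≤ (p x : ℂ) := fun x => by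
    rw [← Complex.ofReal_zero, Complex.real_le_real]; exact hp x
  have hN : 0 < N := by
    rcases Nat.eq_zero_or_pos N with h | h
    · subst h; simp at hp1
    · exact h
  have hNr : (0 : ℝ) < N := by exact_mod_cast hN
  set R := ∑ x, (p x : ℂ) • outer (ψ x) with hRdef
  have hR : R.PosSemidef := Matrix.posSemidef_sum _ fun x _ => (outer_psd (ψ x)).smul (hpc x)
  have htr : R.trace = 1 := by
    rw [hRdef, Matrix.trace_sum]
    have : ∀ x, ((p x : ℂ) • outer (ψ x)).trace = p x := fun x => by
      have := tr_outer 1 (ψ x)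
      rw [Matrix.one_mul, Matrix.one_mulVec, norm_dot _ (hψ x)] at this
      rw [Matrix.trace_smul, this]; simp
    simp only [this]
    rw [← Complex.ofReal_sum, hp1]; simp
  have hl1 : ∑ i, hmix.eigenvalues i = 1 := by
    have := hmix.trace_eq_sum_eigenvalues
    rw [htr] at this
    have h2 := congrArg Complex.re this.symm
    simpa using h2
  obtain ⟨A, hA, hP, hT⟩ := spec_s1 R hR hmix
  have hent := ent_le hmix.eigenvalues (fun i => hR.eigenvalues_nonneg i) hl1
  set T := ∑ i, √(hmix.eigenvalues i) with hTdef
  set a : Fin N → ℝ := fun x => (star (ψ x) ⬝ᵥ (A *ᵥ ψ x)).re with ha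
  have hac : ∀ x, star (ψ x) ⬝ᵥ (A *ᵥ ψ x) = (a x : ℂ) := fun x =>
    Complex.ext (by simp [ha]) (by simpa using hA.im_star_dotProduct_mulVec_self (ψ x))
  have hsumA : ∑ x, p x * a x = T := by
    rw [hRdef, Matrix.mul_sum, Matrix.trace_sum] at hT
    simp only [Matrix.mul_smul, Matrix.trace_smul, tr_outer, hac, smul_eq_mul] at hT
    exact_mod_cast hT
  set M : Fin N → Matrix (Fin n) (Fin n) ℂ := fun x =>
    (p x : ℂ) • (A * outer (ψ x) * A) + (((N : ℝ)⁻¹ : ℝ) : ℂ) • (1 - A * R * A) with hMdef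
  have hMp : IsPOVM M := by
    constructor
    · intro x
      refine Matrix.PosSemidef.add (Matrix.PosSemidef.smul ?_ (hpc x)) (hP.smul ?_)
      · have := (outer_psd (ψ x)).mul_mul_conjTranspose_same A
        rwa [hA.eq] at this
      · rw [← Complex.ofReal_zero, Complex.real_le_real]; positivity
    · have e : ∑ x, (p x : ℂ) • (A * outer (ψ x) * A) = A * R * A := by
        rw [hRdef, Matrix.mul_sum, Matrix.sum_mul]
        simp only [Matrix.mul_smul, Matrix.smul_mul]
      rw [hMdef, Finset.sum_add_distrib, e, Finset.sum_const, Finset.card_univ, Fintype.card_fin,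
        ← Nat.cast_smul_eq_nsmul ℂ, smul_smul]
      have : (N : ℂ) * (((N : ℝ)⁻¹ : ℝ) : ℂ) = 1 := by
        push_cast
        exact mul_inv_cancel₀ (by exact_mod_cast hN.ne')
      rw [this, one_smul]; abel
  have hMx : ∀ x, p x * a x ^ 2 ≤ ((M x * outer (ψ x)).trace).re := by
    intro x
    have e1 : (A * outer (ψ x) * A * outer (ψ x)).trace = ((a x ^ 2 : ℝ) : ℂ) := by
      rw [tr_outer, ← Matrix.mulVec_mulVec, ← Matrix.mulVec_mulVec, outer, Matrix.vecMulVec_mulVec,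
        hac, Matrix.mulVec_smul, dotProduct_smul, hac]
      simp [sq]
    have e2 : 0 ≤ (star (ψ x) ⬝ᵥ ((1 - A * R * A) *ᵥ ψ x)).re :=
      (Complex.le_def.1 (hP.dotProduct_mulVec_nonneg (ψ x))).1
    rw [hMdef]
    simp only [Matrix.add_mul, Matrix.trace_add, Matrix.smul_mul, Matrix.trace_smul, e1]
    rw [tr_outer, smul_eq_mul, smul_eq_mul, Complex.add_re, Complex.re_ofReal_mul,
      Complex.re_ofReal_mul, Complex.ofReal_re]
    have : 0 ≤ (N : ℝ)⁻¹ * (star (ψ x) ⬝ᵥ ((1 - A * R * A) *ᵥ ψ x)).re := by positivity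
    linarith
  have hCS : T ^ 2 ≤ N * ∑ x, (p x * a x) ^ 2 := by
    have := sq_sum_le_card_mul_sum_sq (s := (Finset.univ : Finset (Fin N))) (f := fun x => p x * a x)
    rw [hsumA] at this
    simpa using this
  have hle : ∑ x, (p x * a x) ^ 2 ≤ ∑ x, p x * ((M x * outer (ψ x)).trace).re := by
    refine Finset.sum_le_sum fun x _ => ?_
    have := mul_le_mul_of_nonneg_left (hMx x) (hp x)
    nlinarith
  have hsup : ∑ x, p x * ((M x * outer (ψ x)).trace).re ≤
      sSup (succProbs p (fun x => outer (ψ x))) :=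
    le_csSup (bdd_succ p hp ψ hψ) ⟨M, hMp, rfl⟩
  rw [ge_iff_le, div_le_iff₀ hNr]
  refine hent.trans (hCS.trans ?_)
  rw [mul_comm]
  exact mul_le_mul_of_nonneg_right (hle.trans hsup) hNr.le
end
end

section
/- Let p(x,y) be a joint probability mass function on a finite set X × Y, and let p(y) = Σ_x p(x,y) be the marginal on Y. Then Σ_y max_x p(x,y) ≥ 2^{-H(X|Y)}, where H(X|Y) = -Σ_{(x,y): p(x,y)>0} p(x,y) log₂(p(x,y)/p(y)) is the conditional Shannon entropy. (The left-hand side is the optimal probability of correctly guessing x upon observing y.) -/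
open Matrix Finset Real
open scoped ComplexOrder

noncomputable section

/-- classical guessing probability bound
`Σ_y max_x p(x,y) ≥ 2^{-H(X|Y)}`. -/
theorem classical_guessing_bound {X Y : Type*} [Fintype X] [Fintype Y]
    [Nonempty X] [Nonempty Y]
    (p : X × Y → ℝ) (hp : ∀ z, 0 ≤ p z) (hp1 : ∑ z, p z = 1) :
    ∑ y, Finset.univ.sup' Finset.univ_nonempty (fun x => p (x, y)) ≥
      (2 : ℝ) ^
        (-(-∑ z : X × Y, if 0 < p z then
              p z * Real.logb 2 (p z / ∑ x, p (x, z.2)) else 0)) := by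
  rw [neg_neg, ge_iff_le]
  have hq : ∀ y, 0 ≤ ∑ x, p (x, y) := fun y => Finset.sum_nonneg fun x _ => hp _
  have key := Real.geom_mean_le_arith_mean_weighted Finset.univ p
    (fun z : X × Y => p z / ∑ x, p (x, z.2)) (fun z _ => hp z) hp1
    (fun z _ => div_nonneg (hp z) (hq z.2))
  have hle : ∀ z : X × Y, p z ≤ ∑ x, p (x, z.2) := fun z =>
    Finset.single_le_sum (f := fun x => p (x, z.2)) (fun x _ => hp _) (Finset.mem_univ z.1)
  have e : (2 : ℝ) ^ (∑ z : X × Y, if 0 < p z then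
      p z * Real.logb 2 (p z / ∑ x, p (x, z.2)) else 0) =
      ∏ z : X × Y, (p z / ∑ x, p (x, z.2)) ^ p z := by
    rw [Real.rpow_sum_of_pos (by norm_num)]
    refine Finset.prod_congr rfl fun z _ => ?_
    split_ifs with h
    · rw [mul_comm, Real.rpow_mul (by norm_num), Real.rpow_logb (by norm_num) (by norm_num)]
      exact div_pos h (h.trans_le (hle z))
    · have : p z = 0 := le_antisymm (not_lt.mp h) (hp z)
      simp [this]
  rw [e]
  refine key.trans ?_
  rw [Fintype.sum_prod_type_right]
  refine Finset.sum_le_sum fun y _ => ?_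
  set M := Finset.univ.sup' Finset.univ_nonempty (fun x => p (x, y)) with hM
  have hpM : ∀ x, p (x, y) ≤ M := fun x =>
    Finset.le_sup' (fun x => p (x, y)) (Finset.mem_univ x)
  have hM0 : 0 ≤ M := (hp (Classical.arbitrary X, y)).trans (hpM _)
  calc ∑ x, p (x, y) * (p (x, y) / ∑ x', p (x', y))
      ≤ ∑ x, p (x, y) * (M / ∑ x', p (x', y)) := by
        refine Finset.sum_le_sum fun x _ => mul_le_mul_of_nonneg_left ?_ (hp _)
        exact div_le_div_of_nonneg_right (hpM x) (hq y)
    _ = (∑ x, p (x, y)) * (M / ∑ x', p (x', y)) := by rw [Finset.sum_mul]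
    _ ≤ M := by
        rcases (hq y).eq_or_lt with h | h
        · rw [← h]; simpa using hM0
        · rw [mul_div_cancel₀ _ h.ne']
end
end

section
/- Let p = (p_1,...,p_N) be a probability vector and let ρ_1,...,ρ_N be density matrices on ℂ^n. Let σ be the block-diagonal (Nn)×(Nn) matrix whose x-th diagonal block is p_x ρ_x (this is the classical-quantum state σ_{XQ} = Σ_x p_x |x⟩⟨x| ⊗ ρ_x). Then σ is a density matrix and its von Neumann entropy satisfies S(σ) = H(p) + Σ_x p_x S(ρ_x). -/
open Matrix Finset Real
open scoped ComplexOrder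

noncomputable section

lemma charpoly_smul_aux {m : Type*} [Fintype m] [DecidableEq m] {A : Matrix m m ℂ}
    (hA : A.IsHermitian) (c : ℝ) :
    ((c : ℂ) • A).charpoly
      = ∏ i, (Polynomial.X - Polynomial.C ((c * hA.eigenvalues i : ℝ) : ℂ)) := by
  conv_lhs => rw [hA.spectral_theorem, Unitary.conjStarAlgAut_apply, ← smul_mul_assoc,
    ← mul_smul_comm, charpoly_mul_comm, ← mul_assoc]
  rw [Unitary.coe_star_mul_self, one_mul, ← Matrix.diagonal_smul, charpoly_diagonal]
  simp

lemma charpoly_blockDiagonal_aux {N n : ℕ} (M : Fin N → Matrix (Fin n) (Fin n) ℂ) :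
    (Matrix.blockDiagonal M).charpoly = ∏ x, (M x).charpoly := by
  unfold Matrix.charpoly
  rw [← Matrix.det_blockDiagonal]
  congr 1
  ext ⟨i, x⟩ ⟨j, y⟩ : 2
  by_cases hxy : x = y
  · subst hxy
    by_cases hij : i = j
    · subst hij; simp [Matrix.blockDiagonal_apply]
    · simp [Matrix.blockDiagonal_apply, hij]
  · simp [Matrix.blockDiagonal_apply, hxy]

lemma sum_eigenvalues_aux {N n : ℕ} (p : Fin N → ℝ) (ρ : Fin N → Matrix (Fin n) (Fin n) ℂ)
    (hρ : ∀ x, (ρ x).IsHermitian)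
    (hσ : (Matrix.blockDiagonal (fun x => (p x : ℂ) • ρ x)).IsHermitian) (f : ℝ → ℝ) :
    ∑ i, f (hσ.eigenvalues i) = ∑ x, ∑ i, f (p x * (hρ x).eigenvalues i) := by
  have h1 := hσ.roots_charpoly_eq_eigenvalues
  have h2 : (Matrix.blockDiagonal (fun x => (p x : ℂ) • ρ x)).charpoly
      = (Multiset.map (fun a => Polynomial.X - Polynomial.C a)
        (Multiset.map (fun q : Fin N × Fin n => ((p q.1 * (hρ q.1).eigenvalues q.2 : ℝ) : ℂ))
          Finset.univ.val)).prod := by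
    rw [charpoly_blockDiagonal_aux, Multiset.map_map]
    simp_rw [fun x => charpoly_smul_aux (hρ x) (p x)]
    rw [← Fintype.prod_prod_type' (f := fun x i =>
        Polynomial.X - Polynomial.C ((p x * (hρ x).eigenvalues i : ℝ) : ℂ))]
    rfl
  rw [h2, Polynomial.roots_multiset_prod_X_sub_C] at h1
  have h3 := congrArg (fun s : Multiset ℂ => (s.map (fun z => f z.re)).sum) h1
  simp only [Multiset.map_map, Function.comp_def, Complex.ofReal_re] at h3
  rw [← Fintype.sum_prod_type' (f := fun x i => f (p x * (hρ x).eigenvalues i))]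
  exact h3.symm

open scoped MatrixOrder in
lemma posSemidef_factor_aux {n : ℕ} {A : Matrix (Fin n) (Fin n) ℂ} (hA : A.PosSemidef) :
    ∃ B : Matrix (Fin n) (Fin n) ℂ, A = Bᴴ * B :=
  CStarAlgebra.nonneg_iff_eq_star_mul_self.mp hA.nonneg

/-- the classical-quantum state `σ_XQ = Σ_x p_x |x⟩⟨x| ⊗ ρ_x`
(block diagonal with blocks `p_x ρ_x`) is a density matrix with
`S(σ) = H(p) + Σ_x p_x S(ρ_x)`. -/
theorem cq_state_entropy {N n : ℕ}
    (p : Fin N → ℝ) (hp : ∀ x, 0 ≤ p x) (hp1 : ∑ x, p x = 1)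
    (ρ : Fin N → Matrix (Fin n) (Fin n) ℂ) (hρ : ∀ x, IsDensityMatrix (ρ x)) :
    (Matrix.blockDiagonal (fun x => (p x : ℂ) • ρ x)).PosSemidef ∧
    (Matrix.blockDiagonal (fun x => (p x : ℂ) • ρ x)).trace = 1 ∧
    ∀ hσ : (Matrix.blockDiagonal (fun x => (p x : ℂ) • ρ x)).IsHermitian,
      vonNeumannEntropy (Matrix.blockDiagonal (fun x => (p x : ℂ) • ρ x)) hσ =
        shannonEntropy p + ∑ x, p x * vonNeumannEntropy (ρ x) (hρ x).1.isHermitian := by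
  refine ⟨?_, ?_, ?_⟩
  · have h : ∀ x, ((p x : ℂ) • ρ x).PosSemidef := fun x =>
      (hρ x).1.smul (by exact_mod_cast hp x)
    choose B hB using fun x => posSemidef_factor_aux (h x)
    have : Matrix.blockDiagonal (fun x => (p x : ℂ) • ρ x)
        = (Matrix.blockDiagonal B)ᴴ * Matrix.blockDiagonal B := by
      rw [Matrix.blockDiagonal_conjTranspose, ← Matrix.blockDiagonal_mul]
      congr 1
      funext x
      exact hB x
    rw [this]
    exact Matrix.posSemidef_conjTranspose_mul_self _
  · rw [Matrix.trace_blockDiagonal]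
    simp only [Matrix.trace_smul, (hρ _).2, smul_eq_mul, mul_one]
    exact_mod_cast hp1
  · intro hσ
    have ht : ∀ x, ∑ i, (hρ x).1.isHermitian.eigenvalues i = 1 := fun x => by
      have := (hρ x).1.isHermitian.trace_eq_sum_eigenvalues
      have h' := this.symm.trans (hρ x).2
      simpa using congrArg Complex.re h'
    unfold vonNeumannEntropy shannonEntropy
    rw [sum_eigenvalues_aux p ρ (fun x => (hρ x).1.isHermitian) hσ (fun t => t * Real.logb 2 t),
      ← Finset.sum_neg_distrib, ← Finset.sum_neg_distrib, ← Finset.sum_add_distrib]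
    refine Finset.sum_congr rfl fun x _ => ?_
    have key : ∀ i, p x * (hρ x).1.isHermitian.eigenvalues i
          * Real.logb 2 (p x * (hρ x).1.isHermitian.eigenvalues i)
        = (hρ x).1.isHermitian.eigenvalues i * (p x * Real.logb 2 (p x))
          + p x * ((hρ x).1.isHermitian.eigenvalues i
            * Real.logb 2 ((hρ x).1.isHermitian.eigenvalues i)) := fun i => by
      by_cases h0 : p x = 0
      · simp [h0]
      by_cases h1 : (hρ x).1.isHermitian.eigenvalues i = 0
      · simp [h1]
      rw [Real.logb_mul h0 h1]; ring
    simp_rw [key]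
    rw [Finset.sum_add_distrib, ← Finset.sum_mul, ht, ← Finset.mul_sum]
    ring
end
end
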